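/- Let q = 3^s with s ≥ 3 an odd integer, and let h = 4. Then the BCH code C_4 is a near MDS code with parameters [q + 1, q − 3, 4]: it contains exactly q^{q−3} codewords and its minimum distance is exactly 4; and its dual code D_4 is an almost MDS code with parameters [q + 1, 4, q − 3]: it contains exactly q^4 codewords and its minimum distance is exactly q − 3. -/

import Mathlib

theorem mod_eight_three_pow {s : ℕ} (hs : Odd s) : 3 ^ s % 8 = 3 := by
  obtain ⟨k, rfl⟩ := hs
  rw [pow_succ, pow_mul, Nat.mul_mod, Nat.pow_mod]
  simp

section Circle

variable {K : Type*} [Field K] {s : ℕ}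

theorem eq_neg_one_of_pow_eight_eq_one (hs : Odd s) {r : K} (h8 : r ^ 8 = 1)
    (hr : r ^ 3 ^ s = r) (h1 : r ≠ 1) : r = -1 := by
  have hr0 : r ≠ 0 := by rintro rfl; simp at h8
  rw [pow_eq_pow_mod _ h8, mod_eight_three_pow hs] at hr
  have : r ^ 2 = 1 := mul_left_cancel₀ hr0 (by linear_combination hr)
  exact (mul_self_eq_one_iff.1 ((sq r).symm.trans this)).resolve_left h1

variable [CharP K 3]

theorem sub_pow_of_circle {x y : K} (hx : x ^ (3 ^ s + 1) = 1) (hy : y ^ (3 ^ s + 1) = 1) :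
    (x - y) ^ 3 ^ s * (x * y) = y - x := by
  have : Fact (Nat.Prime 3) := ⟨Nat.prime_three⟩
  rw [sub_pow_char_pow]
  linear_combination y * hx - x * hy

theorem crossRatio_pow_of_circle {u v x y : K} (hu : u ^ (3 ^ s + 1) = 1)
    (hv : v ^ (3 ^ s + 1) = 1) (hx : x ^ (3 ^ s + 1) = 1) (hy : y ^ (3 ^ s + 1) = 1)
    (hxu : x ≠ u) (hyv : y ≠ v) :
    ((y - u) * (x - v) / ((x - u) * (y - v))) ^ 3 ^ s =
      (y - u) * (x - v) / ((x - u) * (y - v)) := by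
  have ne : ∀ z : K, z ^ (3 ^ s + 1) = 1 → z ≠ 0 := by
    rintro z hz rfl; simp at hz
  have hpow : ∀ z w : K, z ^ (3 ^ s + 1) = 1 → w ^ (3 ^ s + 1) = 1 →
      (z - w) ^ 3 ^ s = (w - z) / (z * w) := fun z w hz hw => by
    rw [eq_div_iff (mul_ne_zero (ne z hz) (ne w hw)), sub_pow_of_circle hz hw]
  have := ne u hu
  have := ne v hv
  have := ne x hx
  have := ne y hy
  have := sub_ne_zero.2 hxu
  have := sub_ne_zero.2 hyv
  have := sub_ne_zero.2 hxu.symm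
  have := sub_ne_zero.2 hyv.symm
  rw [div_pow, mul_pow, mul_pow, hpow y u hy hu, hpow x v hx hv, hpow x u hx hu,
    hpow y v hy hv]
  field_simp
  ring

theorem sub_pow_nine (x y : K) : x ^ 9 - y ^ 9 = (x - y) ^ 9 := by
  have : Fact (Nat.Prime 3) := ⟨Nat.prime_three⟩
  exact (sub_pow_char_pow (p := 3) (n := 2) (R := K) (x := x) (y := y)).symm

theorem card_zeros_le_four [DecidableEq K] (hs : Odd s) {a b c d : K} (hab : a ≠ 0 ∨ b ≠ 0)
    (S : Finset K) (hS : ∀ x ∈ S, x ^ (3 ^ s + 1) = 1)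
    (hP : ∀ x ∈ S, b * x ^ 10 + a * x ^ 9 + c * x + d = 0) : S.card ≤ 4 := by
  by_contra! hcard
  obtain ⟨u, hu, v, hv, huv⟩ := Finset.one_lt_card.1 (show 1 < S.card by omega)
  have hcard' : 2 < ((S.erase u).erase v).card := by
    rw [Finset.card_erase_of_mem (Finset.mem_erase.2 ⟨huv.symm, hv⟩),
      Finset.card_erase_of_mem hu]
    omega
  obtain ⟨x, hx, y, hy, z, hz, hxy, hxz, hyz⟩ := Finset.two_lt_card.1 hcard'
  simp only [Finset.mem_erase] at hx hy hz
  obtain ⟨hxv, hxu, hx⟩ := hx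
  obtain ⟨hyv, hyu, hy⟩ := hy
  obtain ⟨hzv, hzu, hz⟩ := hz
  set M := b * (u ^ 9 * v) + a * u ^ 9 + c * v + d with hM
  set N := b * (v ^ 9 * u) + a * v ^ 9 + c * u + d with hN
  have huv0 : u - v ≠ 0 := sub_ne_zero.2 huv
  have key : ∀ w ∈ S, w ≠ u → w ≠ v → M * (w - v) ^ 8 + N * (w - u) ^ 8 = 0 := by
    intro w hw hwu hwv
    refine mul_left_cancel₀ (mul_ne_zero (sub_ne_zero.2 hwu) (sub_ne_zero.2 hwv)) ?_
    have h1 : M * ((w ^ 9 - v ^ 9) * (w - u)) + N * ((w ^ 9 - u ^ 9) * (w - v)) = 0 := by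
      linear_combination (-(v ^ 9 - u ^ 9) * (v - u)) * hP w hw +
        (w ^ 9 - v ^ 9) * (w - v) * hP u hu + (w ^ 9 - u ^ 9) * (w - u) * hP v hv
    rw [sub_pow_nine, sub_pow_nine] at h1
    linear_combination h1
  have hN0 : N ≠ 0 := by
    intro hN0
    have hM0 : M = 0 := by
      have := key x hx hxu hxv
      rw [hN0, zero_mul, add_zero] at this
      exact (mul_eq_zero.1 this).resolve_right (pow_ne_zero _ (sub_ne_zero.2 hxv))
    have hne : (u ^ 9 - v ^ 9) * (u - v) ≠ 0 := by
      rw [sub_pow_nine]; exact mul_ne_zero (pow_ne_zero _ huv0) huv0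
    have hb : b = 0 := mul_left_cancel₀ hne (by
      linear_combination hP u hu + hP v hv - hN.symm.trans hN0 - hM.symm.trans hM0)
    have ha : a = 0 := by
      have hne' : u ^ 9 - v ^ 9 ≠ 0 := left_ne_zero_of_mul hne
      refine mul_left_cancel₀ hne' ?_
      subst hb
      linear_combination hP u hu - hN.symm.trans hN0
    exact hab.elim (fun h => h ha) (fun h => h hb)
  have harm : ∀ w ∈ S, w ≠ u → w ≠ v → w ≠ x →
      (w - u) * (x - v) = -((x - u) * (w - v)) := by
    intro w hw hwu hwv hwx
    have hden : (x - u) * (w - v) ≠ 0 := mul_ne_zero (sub_ne_zero.2 hxu) (sub_ne_zero.2 hwv)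
    have := eq_neg_one_of_pow_eight_eq_one hs (r := (w - u) * (x - v) / ((x - u) * (w - v))) (by
        rw [div_pow, div_eq_one_iff_eq (pow_ne_zero _ hden)]
        refine mul_left_cancel₀ hN0 ?_
        linear_combination (x - v) ^ 8 * key w hw hwu hwv - (w - v) ^ 8 * key x hx hxu hxv)
      (crossRatio_pow_of_circle (hS u hu) (hS v hv) (hS x hx) (hS w hw) hxu hwv) (by
        rw [Ne, div_eq_one_iff_eq hden]
        intro h
        exact mul_ne_zero (sub_ne_zero.2 hwx) huv0 (by linear_combination h))
    rw [div_eq_iff hden] at this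
    rw [this, neg_one_mul]
  have hy' := harm y hy hyu hyv hxy.symm
  have hz' := harm z hz hzu hzv hxz.symm
  refine mul_ne_zero (mul_ne_zero (sub_ne_zero.2 hxv)
    (sub_ne_zero.2 hyz)) (mul_ne_zero huv0 (sub_ne_zero.2 hxu)) ?_
  have h3 : (x - v) * (x - u) * ((y - u) * (z - v) - (z - u) * (y - v)) = 0 := by
    linear_combination (x - u) * ((z - v) * hy' - (y - v) * hz')
  linear_combination h3

theorem eq_zero_of_three_term_relation {x y z e f g : K} (hxz : x ≠ z) (hyz : y ≠ z)
    (h0 : e + f + g = 0) (h1 : e * x + f * y + g * z = 0)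
    (h9 : e * x ^ 9 + f * y ^ 9 + g * z ^ 9 = 0)
    (h10 : e * x ^ 10 + f * y ^ 10 + g * z ^ 10 = 0) : g = 0 := by
  have h : g * ((z ^ 9 - x ^ 9) * (z - y)) = 0 := by
    linear_combination h10 - y * h9 - x ^ 9 * h1 + x ^ 9 * y * h0
  rw [sub_pow_nine] at h
  exact (mul_eq_zero.1 h).resolve_right
    (mul_ne_zero (pow_ne_zero _ (sub_ne_zero.2 hxz.symm)) (sub_ne_zero.2 hyz.symm))

end Circle

section TraceCode

/-- The evaluation map `(a, b) ↦ (Tr (a β ^ (4 j) + b β ^ (5 j)))_j`. -/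
noncomputable def traceEncoder (F : Type*) {K : Type*} [Field F] [Field K] [Algebra F K] (β : K)
    (n : ℕ) : (K × K) →ₗ[F] (Fin n → F) :=
  LinearMap.pi fun j => Algebra.trace F K ∘ₗ
    ((LinearMap.mulRight F (β ^ (4 * (j : ℕ)))).coprod (LinearMap.mulRight F (β ^ (5 * (j : ℕ)))))

variable {F K : Type*} [Field F] [Field K] [Algebra F K]

theorem traceEncoder_apply (β : K) (n : ℕ) (p : K × K) (j : Fin n) :
    traceEncoder F β n p j =
      Algebra.trace F K (p.1 * β ^ (4 * (j : ℕ)) + p.2 * β ^ (5 * (j : ℕ))) := by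
  simp [traceEncoder]

theorem card_zeros_add_hammingNorm {ι R : Type*} [Fintype ι] [Zero R] [DecidableEq R]
    (c : ι → R) :
    (Finset.univ.filter fun j => c j = 0).card + hammingNorm c = Fintype.card ι :=
  Finset.card_filter_add_card_filter_not _

/-- The exponents of the fourth roots of unity among the powers of a primitive `4 m`-th root. -/
def quarterPoint {n m : ℕ} (h : n = 4 * m) (hm : 0 < m) : Fin 4 ↪ Fin n where
  toFun k := ⟨k * m, by subst h; exact Nat.mul_lt_mul_of_pos_right k.2 hm⟩
  inj' i j hij := Fin.ext (Nat.eq_of_mul_eq_mul_right hm (by simpa using hij))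

theorem quarterPoint_val {n m : ℕ} (h : n = 4 * m) (hm : 0 < m) (k : Fin 4) :
    (quarterPoint h hm k : ℕ) = k * m := rfl

theorem IsPrimitiveRoot.sq_pow_quarter {R : Type*} [CommRing R] [IsDomain R] {β : R} {n m : ℕ}
    (hβ : IsPrimitiveRoot β n) (h : n = 4 * m) (hm : 0 < m) : (β ^ m) ^ 2 = -1 := by
  have h4 : IsPrimitiveRoot (β ^ m) 4 := hβ.pow (by omega) (by rw [h, mul_comm])
  have h2 : IsPrimitiveRoot ((β ^ m) ^ 2) 2 := h4.pow (by norm_num) rfl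
  exact h2.eq_neg_one_of_two_right

theorem exists_parity_hammingNorm_le_four [DecidableEq F] {β : K} {n m : ℕ}
    (hβ : IsPrimitiveRoot β n) (h : n = 4 * m) (hm : 0 < m) :
    ∃ c : Fin n → F, (∑ j, algebraMap F K (c j) * β ^ (4 * (j : ℕ)) = 0) ∧
      (∑ j, algebraMap F K (c j) * β ^ (5 * (j : ℕ)) = 0) ∧ c ≠ 0 ∧ hammingNorm c ≤ 4 := by
  set e := quarterPoint h hm with he
  have hi := hβ.sq_pow_quarter h hm
  set c : Fin n → F := fun j => ∑ k : Fin 4, if e k = j then (-1) ^ (k : ℕ) else 0 with hc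
  have hsum : ∀ f : Fin n → K,
      ∑ j, algebraMap F K (c j) * f j = ∑ k : Fin 4, (-1) ^ (k : ℕ) * f (e k) := by
    intro f
    simp only [hc, map_sum, Finset.sum_mul]
    rw [Finset.sum_comm]
    refine Finset.sum_congr rfl fun k _ => ?_
    rw [Finset.sum_eq_single (e k)]
    · simp
    · intro j _ hj
      simp [hj.symm]
    · simp
  have hpow : ∀ r (k : Fin 4), β ^ (r * (e k : ℕ)) = ((β ^ m) ^ (k : ℕ)) ^ r := fun r k => by
    rw [he, quarterPoint_val, ← pow_mul, ← pow_mul]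
    congr 1
    ring
  refine ⟨c, ?_, ?_, ?_, ?_⟩
  · rw [hsum]
    simp only [hpow]
    generalize β ^ m = i at hi
    simp only [Fin.sum_univ_four, Fin.coe_ofNat_eq_mod]
    linear_combination -(i ^ 2 - 1) * (1 + i ^ 8) * hi
  · rw [hsum]
    simp only [hpow]
    generalize β ^ m = i at hi
    simp only [Fin.sum_univ_four, Fin.coe_ofNat_eq_mod]
    linear_combination (1 - i ^ 5) * (1 - i ^ 2 + i ^ 4 - i ^ 6 + i ^ 8) * hi
  · intro h0
    have := congrFun h0 (e 0)
    simp [hc] at this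
  · unfold hammingNorm
    calc _ ≤ (Finset.univ.map e).card := Finset.card_le_card fun j hj => by
            by_contra hj'
            refine (Finset.mem_filter.1 hj).2 (Finset.sum_eq_zero fun k _ => if_neg fun hk => ?_)
            exact hj' (Finset.mem_map.2 ⟨k, Finset.mem_univ _, hk⟩)
      _ = 4 := by simp

variable {s : ℕ} [Fintype F]

theorem conj_relation [CharP K 3] (hF : Fintype.card F = 3 ^ s) {β : K} {n : ℕ} {c : Fin n → F}
    (t : Finset (Fin n)) (k : ℕ) (h : ∑ j ∈ t, algebraMap F K (c j) * β ^ (k * (j : ℕ)) = 0) :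
    ∑ j ∈ t, algebraMap F K (c j) * ((β ^ (j : ℕ)) ^ 3 ^ s) ^ k = 0 := by
  have : Fact (Nat.Prime 3) := ⟨Nat.prime_three⟩
  have h' := congrArg (· ^ 3 ^ s) h
  simp only [sum_pow_char_pow, mul_pow, ← map_pow] at h'
  rw [zero_pow (by positivity)] at h'
  rw [← h']
  refine Finset.sum_congr rfl fun j _ => ?_
  rw [← hF, FiniteField.pow_card, pow_mul' β k, pow_right_comm]

theorem four_le_hammingNorm_of_parity [DecidableEq F] [CharP K 3] (hs3 : 3 ≤ s)
    (hF : Fintype.card F = 3 ^ s) {β : K} (hβ : IsPrimitiveRoot β (3 ^ s + 1))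
    {c : Fin (3 ^ s + 1) → F} (h4 : ∑ j, algebraMap F K (c j) * β ^ (4 * (j : ℕ)) = 0)
    (h5 : ∑ j, algebraMap F K (c j) * β ^ (5 * (j : ℕ)) = 0) (hc : c ≠ 0) :
    4 ≤ hammingNorm c := by
  by_contra! hlt
  have hq : 3 ^ 3 ≤ 3 ^ s := Nat.pow_le_pow_right (by norm_num) hs3
  obtain ⟨t, hsub, ht⟩ := Finset.exists_superset_card_eq (n := 3)
    (s := Finset.univ.filter fun j => c j ≠ 0) (by unfold hammingNorm at hlt; omega)
    (by rw [Fintype.card_fin]; omega)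
  have hout : ∀ j, j ∉ t → c j = 0 := fun j hj => by
    by_contra h
    exact hj (hsub (Finset.mem_filter.2 ⟨Finset.mem_univ _, h⟩))
  have restrict : ∀ f : Fin (3 ^ s + 1) → K, ∑ j, algebraMap F K (c j) * f j = 0 →
      ∑ j ∈ t, algebraMap F K (c j) * f j = 0 := fun f hf => by
    rw [← hf]
    refine Finset.sum_subset (Finset.subset_univ _) fun j _ hj => ?_
    rw [hout j hj, map_zero, zero_mul]
  have r4 := restrict _ h4
  have r5 := restrict _ h5
  have c4 := conj_relation hF t 4 r4
  have c5 := conj_relation hF t 5 r5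
  have hx : ∀ j : ℕ, (β ^ j) ^ 3 ^ s * β ^ j = 1 := fun j => by
    rw [← pow_succ, pow_right_comm, hβ.pow_eq_one, one_pow]
  have hne : ∀ {i j : Fin (3 ^ s + 1)}, i ≠ j → β ^ (i : ℕ) ≠ β ^ (j : ℕ) := fun hij h =>
    hij (Fin.ext (hβ.pow_inj (Fin.is_lt _) (Fin.is_lt _) h))
  have vanish : ∀ i j k : Fin (3 ^ s + 1), t = {i, j, k} → i ≠ j → i ≠ k → j ≠ k → c k = 0 := by
    rintro i j k rfl hij hik hjk
    have hni : i ∉ ({j, k} : Finset (Fin (3 ^ s + 1))) := by simp [hij, hik]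
    have hnj : j ∉ ({k} : Finset (Fin (3 ^ s + 1))) := by simp [hjk]
    simp only [Finset.sum_insert hni, Finset.sum_insert hnj, Finset.sum_singleton, pow_mul'] at *
    have hi := hx i
    have hj := hx j
    have hk := hx k
    have hik' := hne hik
    have hjk' := hne hjk
    have hxk : (β ^ (k : ℕ)) ^ 3 ^ s ≠ 0 := left_ne_zero_of_mul_eq_one hk
    generalize (β ^ (i : ℕ)) ^ 3 ^ s = x' at *
    generalize (β ^ (j : ℕ)) ^ 3 ^ s = y' at *
    generalize (β ^ (k : ℕ)) ^ 3 ^ s = z' at *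
    generalize β ^ (i : ℕ) = x at *
    generalize β ^ (j : ℕ) = y at *
    generalize β ^ (k : ℕ) = z at *
    have p5 : ∀ w w' : K, w' * w = 1 → w' ^ 5 * w ^ 5 = 1 := fun w w' h => by
      rw [← mul_pow, h, one_pow]
    have hz := eq_zero_of_three_term_relation (e := algebraMap F K (c i) * x' ^ 5)
      (f := algebraMap F K (c j) * y' ^ 5) (g := algebraMap F K (c k) * z' ^ 5) hik' hjk'
      (by linear_combination c5)
      (by linear_combination c4 + algebraMap F K (c i) * x' ^ 4 * hi +
            algebraMap F K (c j) * y' ^ 4 * hj + algebraMap F K (c k) * z' ^ 4 * hk)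
      (by linear_combination r4 + algebraMap F K (c i) * x ^ 4 * p5 _ _ hi +
            algebraMap F K (c j) * y ^ 4 * p5 _ _ hj + algebraMap F K (c k) * z ^ 4 * p5 _ _ hk)
      (by linear_combination r5 + algebraMap F K (c i) * x ^ 5 * p5 _ _ hi +
            algebraMap F K (c j) * y ^ 5 * p5 _ _ hj + algebraMap F K (c k) * z ^ 5 * p5 _ _ hk)
    exact (map_eq_zero _).1 ((mul_eq_zero.1 hz).resolve_right (pow_ne_zero _ hxk))
  obtain ⟨i, j, k, hij, hik, hjk, rfl⟩ := Finset.card_eq_three.1 ht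
  have hk := vanish i j k rfl hij hik hjk
  have hj := vanish i k j (by rw [Finset.pair_comm]) hik hij hjk.symm
  have hi := vanish j k i (by ext; simp; tauto) hjk hij.symm hik.symm
  refine hc (funext fun l => ?_)
  by_cases hl : l ∈ ({i, j, k} : Finset (Fin (3 ^ s + 1)))
  · simp only [Finset.mem_insert, Finset.mem_singleton] at hl
    rcases hl with rfl | rfl | rfl <;> assumption
  · exact hout l hl

variable [Fintype K]

theorem finrank_eq_two_of_card {q : ℕ} (hF : Fintype.card F = q) (hK : Fintype.card K = q ^ 2) :
    Module.finrank F K = 2 := by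
  have h := Module.card_eq_pow_finrank (K := F) (V := K)
  rw [hK, hF] at h
  exact (Nat.pow_right_injective (hF ▸ Fintype.one_lt_card) h).symm

theorem algebraMap_trace_of_card {q : ℕ} (hF : Fintype.card F = q)
    (hK : Fintype.card K = q ^ 2) (x : K) :
    algebraMap F K (Algebra.trace F K x) = x + x ^ q := by
  rw [FiniteField.algebraMap_trace_eq_sum_pow, finrank_eq_two_of_card hF hK,
    Nat.card_eq_fintype_card, hF]
  simp [Finset.sum_range_succ]

theorem algebraMap_traceEncoder_mul [CharP K 3] (hF : Fintype.card F = 3 ^ s)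
    (hK : Fintype.card K = (3 ^ s) ^ 2) {β : K} (hβ : β ^ (3 ^ s + 1) = 1) (n : ℕ) (p : K × K)
    (j : Fin n) :
    algebraMap F K (traceEncoder F β n p j) * (β ^ (j : ℕ)) ^ 5 =
      p.2 * (β ^ (j : ℕ)) ^ 10 + p.1 * (β ^ (j : ℕ)) ^ 9 + p.1 ^ 3 ^ s * β ^ (j : ℕ) +
        p.2 ^ 3 ^ s := by
  have : Fact (Nat.Prime 3) := ⟨Nat.prime_three⟩
  rw [traceEncoder_apply, algebraMap_trace_of_card hF hK, add_pow_char_pow, mul_pow, mul_pow,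
    pow_mul' β 4, pow_mul' β 5]
  have hx : (β ^ (j : ℕ)) ^ 3 ^ s * β ^ (j : ℕ) = 1 := by
    rw [← pow_succ, pow_right_comm, hβ, one_pow]
  rw [pow_right_comm _ 4, pow_right_comm _ 5]
  generalize β ^ (j : ℕ) = x at *
  generalize x ^ 3 ^ s = y at *
  have h4 : y ^ 4 * x ^ 4 = 1 := by rw [← mul_pow, hx, one_pow]
  have h5 : y ^ 5 * x ^ 5 = 1 := by rw [← mul_pow, hx, one_pow]
  linear_combination p.1 ^ 3 ^ s * x * h4 + p.2 ^ 3 ^ s * h5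

theorem card_zeros_traceEncoder_le [DecidableEq F] [CharP K 3] (hs : Odd s)
    (hF : Fintype.card F = 3 ^ s) (hK : Fintype.card K = (3 ^ s) ^ 2) {β : K}
    (hβ : IsPrimitiveRoot β (3 ^ s + 1)) {p : K × K} (hp : p ≠ 0) :
    (Finset.univ.filter fun j => traceEncoder F β (3 ^ s + 1) p j = 0).card ≤ 4 := by
  classical
  have hinj : Function.Injective fun j : Fin (3 ^ s + 1) => β ^ (j : ℕ) := fun i j h =>
    Fin.ext (hβ.pow_inj i.2 j.2 h)
  rw [← Finset.card_image_of_injective _ hinj]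
  refine card_zeros_le_four hs (a := p.1) (b := p.2) ?_ _ ?_ ?_ (c := p.1 ^ 3 ^ s)
    (d := p.2 ^ 3 ^ s)
  · by_contra! h
    exact hp (Prod.ext h.1 h.2)
  · simp only [Finset.forall_mem_image]
    intro j _
    rw [pow_right_comm, hβ.pow_eq_one, one_pow]
  · simp only [Finset.forall_mem_image]
    intro j hj
    rw [← algebraMap_traceEncoder_mul hF hK hβ.pow_eq_one, (Finset.mem_filter.1 hj).2, map_zero,
      zero_mul]

theorem le_hammingNorm_traceEncoder [DecidableEq F] [CharP K 3] (hs : Odd s)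
    (hF : Fintype.card F = 3 ^ s) (hK : Fintype.card K = (3 ^ s) ^ 2) {β : K}
    (hβ : IsPrimitiveRoot β (3 ^ s + 1)) {p : K × K} (hp : p ≠ 0) :
    3 ^ s - 3 ≤ hammingNorm (traceEncoder F β (3 ^ s + 1) p) := by
  have h1 := card_zeros_traceEncoder_le hs hF hK hβ hp
  have h2 := card_zeros_add_hammingNorm (traceEncoder F β (3 ^ s + 1) p)
  rw [Fintype.card_fin] at h2
  omega

theorem traceEncoder_injective [CharP K 3] (hs : Odd s) (hs3 : 3 ≤ s)
    (hF : Fintype.card F = 3 ^ s) (hK : Fintype.card K = (3 ^ s) ^ 2) {β : K}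
    (hβ : IsPrimitiveRoot β (3 ^ s + 1)) :
    Function.Injective (traceEncoder F β (3 ^ s + 1)) := by
  classical
  rw [injective_iff_map_eq_zero]
  intro p hp
  by_contra hne
  have h := le_hammingNorm_traceEncoder hs hF hK hβ hne
  have : 3 ^ 3 ≤ 3 ^ s := Nat.pow_le_pow_right (by norm_num) hs3
  rw [hp, hammingNorm_zero] at h
  omega

/-- Delsarte duality: the code with parity checks `∑ c_j β ^ (4 j) = ∑ c_j β ^ (5 j) = 0` is the
orthogonal complement of the image of `traceEncoder`. -/
theorem mem_dualAnnihilator_range_traceEncoder_iff (β : K) (n : ℕ) (c : Fin n → F) :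
    dotProductEquiv F (Fin n) c ∈ (LinearMap.range (traceEncoder F β n)).dualAnnihilator ↔
      ∑ j, algebraMap F K (c j) * β ^ (4 * (j : ℕ)) = 0 ∧
        ∑ j, algebraMap F K (c j) * β ^ (5 * (j : ℕ)) = 0 := by
  have hsum : ∀ p : K × K, dotProductEquiv F (Fin n) c (traceEncoder F β n p) =
      Algebra.trace F K (p.1 * ∑ j, algebraMap F K (c j) * β ^ (4 * (j : ℕ)) +
        p.2 * ∑ j, algebraMap F K (c j) * β ^ (5 * (j : ℕ))) := by
    intro p
    rw [dotProductEquiv_apply_apply, dotProduct, Finset.mul_sum, Finset.mul_sum,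
      ← Finset.sum_add_distrib, map_sum]
    refine Finset.sum_congr rfl fun j _ => ?_
    rw [traceEncoder_apply, ← smul_eq_mul, ← map_smul, Algebra.smul_def]
    congr 1
    ring
  rw [Submodule.mem_dualAnnihilator]
  simp only [LinearMap.mem_range, forall_exists_index, forall_apply_eq_imp_iff, hsum]
  obtain ⟨y, hy⟩ := Algebra.trace_surjective F K 1
  constructor
  · intro h
    constructor <;> by_contra hne
    · have := h (y / ∑ j, algebraMap F K (c j) * β ^ (4 * (j : ℕ)), 0)
      rw [zero_mul, add_zero, div_mul_cancel₀ _ hne, hy] at this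
      exact one_ne_zero this
    · have := h (0, y / ∑ j, algebraMap F K (c j) * β ^ (5 * (j : ℕ)))
      rw [zero_mul, zero_add, div_mul_cancel₀ _ hne, hy] at this
      exact one_ne_zero this
  · rintro ⟨h1, h2⟩ p
    rw [h1, h2, mul_zero, mul_zero, add_zero, map_zero]

theorem hammingNorm_traceEncoder_quarter_le [DecidableEq F] [CharP K 3]
    (hF : Fintype.card F = 3 ^ s) (hK : Fintype.card K = (3 ^ s) ^ 2) {β : K} {m : ℕ}
    (hβ : IsPrimitiveRoot β (3 ^ s + 1)) (h : 3 ^ s + 1 = 4 * m) (hm : 0 < m) :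
    hammingNorm (traceEncoder F β (3 ^ s + 1) (β ^ m, 0)) ≤ 3 ^ s - 3 := by
  have hi := hβ.sq_pow_quarter h hm
  have hzero : Finset.univ.map (quarterPoint h hm) ⊆
      Finset.univ.filter fun j => traceEncoder F β (3 ^ s + 1) (β ^ m, 0) j = 0 := by
    intro j hj
    obtain ⟨k, -, rfl⟩ := Finset.mem_map.1 hj
    refine Finset.mem_filter.2 ⟨Finset.mem_univ _, ?_⟩
    have key := algebraMap_traceEncoder_mul hF hK hβ.pow_eq_one (3 ^ s + 1) (β ^ m, 0)
      (quarterPoint h hm k)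
    have hx : β ^ (quarterPoint h hm k : ℕ) ≠ 0 := pow_ne_zero _ (hβ.ne_zero (by positivity))
    have hx8 : (β ^ (quarterPoint h hm k : ℕ)) ^ 8 = 1 := by
      rw [quarterPoint_val, pow_mul', pow_right_comm, pow_mul (β ^ m) 2 4, hi,
        Even.neg_one_pow (by decide), one_pow]
    have hconj : (β ^ m) ^ 3 ^ s * β ^ m = 1 := by
      rw [← pow_succ, pow_right_comm, hβ.pow_eq_one, one_pow]
    have hi0 : β ^ m ≠ 0 := right_ne_zero_of_mul_eq_one hconj
    have hconj' : (β ^ m) ^ 3 ^ s = -β ^ m :=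
      mul_right_cancel₀ hi0 (by linear_combination hconj + hi)
    rw [hconj', zero_pow (by positivity)] at key
    refine (map_eq_zero (algebraMap F K)).1 ((mul_eq_zero.1 (key.trans ?_)).resolve_right
      (pow_ne_zero _ hx))
    linear_combination β ^ m * β ^ (quarterPoint h hm k : ℕ) * hx8
  have h1 := Finset.card_le_card hzero
  have h2 := card_zeros_add_hammingNorm (traceEncoder F β (3 ^ s + 1) (β ^ m, 0))
  rw [Finset.card_map, Finset.card_univ, Fintype.card_fin] at h1
  rw [Fintype.card_fin] at h2
  omega

end TraceCode

theorem stmt8 (s : ℕ) (hs : 3 ≤ s) (hsodd : Odd s) (q : ℕ) (hq : q = 3 ^ s)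
    (F K : Type) [Field F] [Field K] [Fintype F] [Fintype K] [DecidableEq F]
    [Algebra F K] (hF : Fintype.card F = q) (hK : Fintype.card K = q ^ 2)
    (β : K) (hβ : IsPrimitiveRoot β (q + 1))
    (C : Set (Fin (q + 1) → F))
    (hC : C = {c | (∑ j : Fin (q + 1), algebraMap F K (c j) * β ^ (4 * (j : ℕ)) = 0) ∧
      (∑ j : Fin (q + 1), algebraMap F K (c j) * β ^ (5 * (j : ℕ)) = 0)})
    (D : Set (Fin (q + 1) → F))
    (hD : D = {c | ∃ a b : K, ∀ j : Fin (q + 1),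
      c j = Algebra.trace F K (a * β ^ (4 * (j : ℕ)) + b * β ^ (5 * (j : ℕ)))}) :
    C.ncard = q ^ (q - 3) ∧
    IsLeast {w : ℕ | ∃ c ∈ C, c ≠ 0 ∧ hammingNorm c = w} 4 ∧
    D.ncard = q ^ 4 ∧
    IsLeast {w : ℕ | ∃ c ∈ D, c ≠ 0 ∧ hammingNorm c = w} (q - 3) := by
  subst hq
  have : Fact (Nat.Prime 3) := ⟨Nat.prime_three⟩
  have : CharP K 3 := charP_of_card_eq_prime_pow (f := s * 2) (by rw [hK, pow_mul])
  have h27 : 3 ^ 3 ≤ 3 ^ s := Nat.pow_le_pow_right (by norm_num) hs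
  have hinj := traceEncoder_injective hsodd hs hF hK hβ (F := F)
  obtain ⟨m, hm⟩ : 4 ∣ 3 ^ s + 1 := by
    have := mod_eight_three_pow hsodd
    omega
  have hm0 : 0 < m := by omega
  have hCmem : ∀ c, c ∈ C ↔ dotProductEquiv F (Fin (3 ^ s + 1)) c ∈
      (LinearMap.range (traceEncoder F β (3 ^ s + 1))).dualAnnihilator := fun c => by
    rw [mem_dualAnnihilator_range_traceEncoder_iff, hC, Set.mem_ofPred_eq]
  have hDrange : D = Set.range (traceEncoder F β (3 ^ s + 1)) := by
    rw [hD]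
    ext c
    constructor
    · rintro ⟨a, b, h⟩
      exact ⟨(a, b), funext fun j => by rw [traceEncoder_apply, h]⟩
    · rintro ⟨p, rfl⟩
      exact ⟨p.1, p.2, fun j => traceEncoder_apply ..⟩
  refine ⟨?_, ⟨?_, ?_⟩, ?_, ⟨?_, ?_⟩⟩
  · set W := (LinearMap.range (traceEncoder F β (3 ^ s + 1))).dualAnnihilator with hW
    have hrank : Module.finrank F W = 3 ^ s - 3 := by
      have h := Subspace.finrank_add_finrank_dualAnnihilator_eq
        (LinearMap.range (traceEncoder F β (3 ^ s + 1)))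
      rw [LinearMap.finrank_range_of_inj hinj, Module.finrank_prod,
        finrank_eq_two_of_card hF hK, Module.finrank_fin_fun, ← hW] at h
      omega
    have hCW : C = dotProductEquiv F (Fin (3 ^ s + 1)) ⁻¹' W := Set.ext hCmem
    rw [hCW, Set.ncard_preimage_of_injective_subset_range (LinearEquiv.injective _)
      (fun x _ => LinearEquiv.surjective _ x), ← Nat.card_coe_set_eq, SetLike.coe_sort_coe,
      Module.natCard_eq_pow_finrank (K := F), hrank, Nat.card_eq_fintype_card, hF]
  · obtain ⟨c, h4, h5, hc, hle⟩ := exists_parity_hammingNorm_le_four (F := F) hβ hm hm0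
    exact ⟨c, by rw [hC]; exact ⟨h4, h5⟩, hc,
      le_antisymm hle (four_le_hammingNorm_of_parity hs hF hβ h4 h5 hc)⟩
  · rintro w ⟨c, hcC, hc, rfl⟩
    rw [hC] at hcC
    exact four_le_hammingNorm_of_parity hs hF hβ hcC.1 hcC.2 hc
  · rw [hDrange, ← Set.image_univ, Set.ncard_image_of_injective _ hinj, Set.ncard_univ,
      Nat.card_eq_fintype_card, Fintype.card_prod, hK]
    ring
  · have hne : ((β ^ m, 0) : K × K) ≠ 0 := fun h =>
      pow_ne_zero m (hβ.ne_zero (by positivity)) (congrArg Prod.fst h)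
    refine ⟨_, hDrange ▸ Set.mem_range_self (β ^ m, 0), ?_,
      le_antisymm (hammingNorm_traceEncoder_quarter_le hF hK hβ hm hm0)
        (le_hammingNorm_traceEncoder hsodd hF hK hβ hne)⟩
    exact (map_ne_zero_iff _ hinj).2 hne
  · rintro w ⟨c, hcD, hc, rfl⟩
    rw [hDrange] at hcD
    obtain ⟨p, rfl⟩ := hcD
    exact le_hammingNorm_traceEncoder hsodd hF hK hβ fun h => hc (by rw [h, map_zero])
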